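/- (i) The sequences (a_n, b_n) form a Bailey pair relative to 1, where a_{2n} = (1 − q^{4n}) q^{2n²−2n} ∑_{j=−n}^{n−1} q^{−4j²−3j}, a_{2n+1} = −(1 − q^{4n+2}) q^{2n²} ∑_{j=−n}^{n} q^{−4j²−j}, b_0 = 0, and b_n = (−1)^n q^{−C(n,2)} / ((q)_{n−1} (1 − q^{2n−1})) for n ≥ 1. (ii) The sequences (α_n, β_n) form a Bailey pair relative to q, where α_{2n} = (1/(1−q)) ( q^{2n²} ∑_{j=−n}^{n} q^{−4j²−j} + q^{2n²+2n} ∑_{j=−n}^{n−1} q^{−4j²−3j} ), α_{2n+1} = −(1/(1−q)) ( q^{2n²+2n} ∑_{j=−n−1}^{n} q^{−4j²−3j} + q^{2n²+4n+2} ∑_{j=−n}^{n} q^{−4j²−j} ), and β_n = (−1)^n q^{−C(n+1,2)} / ((q)_n (1 − q^{2n+1})). -/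

import Mathlib

/-- The indeterminate `q` of the field of formal Laurent series `ℚ((q))`. -/
noncomputable def q : LaurentSeries ℚ := HahnSeries.single 1 1

/-- The q-Pochhammer symbol `(a; b)_n = ∏_{j=0}^{n-1} (1 - a * b^j)` in `ℚ((q))`. -/
noncomputable def poch (a b : LaurentSeries ℚ) (n : ℕ) : LaurentSeries ℚ :=
  ∏ j ∈ Finset.range n, (1 - a * b ^ j)

/-- `(α, β)` is a Bailey pair relative to `a`:
`β_n = ∑_{k=0}^n α_k / ((q)_{n-k} (aq)_{n+k})` for all `n ≥ 0`. -/
def IsBaileyPair (a : LaurentSeries ℚ) (α β : ℕ → LaurentSeries ℚ) : Prop :=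
  ∀ n : ℕ, β n =
    ∑ k ∈ Finset.range (n + 1), α k / (poch q q (n - k) * poch (a * q) q (n + k))

/-- `a_{2n} = (1 - q^{4n}) q^{2n²-2n} ∑_{j=-n}^{n-1} q^{-4j²-3j}`. -/
noncomputable def aEven (n : ℕ) : LaurentSeries ℚ :=
  (1 - q ^ (4 * n)) * q ^ (2 * n ^ 2 - 2 * n) *
    ∑ j ∈ Finset.Icc (-(n : ℤ)) ((n : ℤ) - 1), q ^ (-4 * j ^ 2 - 3 * j)

/-- `a_{2n+1} = -(1 - q^{4n+2}) q^{2n²} ∑_{j=-n}^{n} q^{-4j²-j}`. -/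
noncomputable def aOdd (n : ℕ) : LaurentSeries ℚ :=
  -((1 - q ^ (4 * n + 2)) * q ^ (2 * n ^ 2) *
    ∑ j ∈ Finset.Icc (-(n : ℤ)) (n : ℤ), q ^ (-4 * j ^ 2 - j))

/-- The sequence `a` of Proposition 2.2(i). -/
noncomputable def a (m : ℕ) : LaurentSeries ℚ :=
  if m % 2 = 0 then aEven (m / 2) else aOdd (m / 2)

/-- The sequence `b` of Proposition 2.2(i): `b_0 = 0` and
`b_n = (-1)ⁿ q^{-C(n,2)} / ((q)_{n-1} (1 - q^{2n-1}))` for `n ≥ 1`. -/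
noncomputable def b (n : ℕ) : LaurentSeries ℚ :=
  if n = 0 then 0
  else (-1) ^ n * q ^ (-(n.choose 2 : ℤ)) / (poch q q (n - 1) * (1 - q ^ (2 * n - 1)))

/-- `α_{2n} = (1/(1-q)) (q^{2n²} ∑_{j=-n}^{n} q^{-4j²-j} + q^{2n²+2n} ∑_{j=-n}^{n-1} q^{-4j²-3j})`. -/
noncomputable def αEven (n : ℕ) : LaurentSeries ℚ :=
  (q ^ (2 * n ^ 2) * ∑ j ∈ Finset.Icc (-(n : ℤ)) (n : ℤ), q ^ (-4 * j ^ 2 - j) +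
    q ^ (2 * n ^ 2 + 2 * n) *
      ∑ j ∈ Finset.Icc (-(n : ℤ)) ((n : ℤ) - 1), q ^ (-4 * j ^ 2 - 3 * j)) / (1 - q)

/-- `α_{2n+1} = -(1/(1-q)) (q^{2n²+2n} ∑_{j=-n-1}^{n} q^{-4j²-3j} + q^{2n²+4n+2} ∑_{j=-n}^{n} q^{-4j²-j})`. -/
noncomputable def αOdd (n : ℕ) : LaurentSeries ℚ :=
  -((q ^ (2 * n ^ 2 + 2 * n) *
      ∑ j ∈ Finset.Icc (-(n : ℤ) - 1) (n : ℤ), q ^ (-4 * j ^ 2 - 3 * j) +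
    q ^ (2 * n ^ 2 + 4 * n + 2) *
      ∑ j ∈ Finset.Icc (-(n : ℤ)) (n : ℤ), q ^ (-4 * j ^ 2 - j)) / (1 - q))

/-- The sequence `α` of Proposition 2.2(ii). -/
noncomputable def α (m : ℕ) : LaurentSeries ℚ :=
  if m % 2 = 0 then αEven (m / 2) else αOdd (m / 2)

/-- The sequence `β` of Proposition 2.2(ii):
`β_n = (-1)ⁿ q^{-C(n+1,2)} / ((q)_n (1 - q^{2n+1}))`. -/
noncomputable def β (n : ℕ) : LaurentSeries ℚ :=
  (-1) ^ n * q ^ (-((n + 1).choose 2 : ℤ)) / (poch q q n * (1 - q ^ (2 * n + 1)))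

lemma q_ne : q ≠ 0 := by
  unfold q
  exact HahnSeries.single_ne_zero one_ne_zero

lemma q_pow (n : ℕ) : q ^ n = HahnSeries.single (n : ℤ) (1 : ℚ) := by
  unfold q
  rw [HahnSeries.single_pow]
  simp

lemma one_sub_q_pow_ne (n : ℕ) (hn : 0 < n) : (1 : LaurentSeries ℚ) - q ^ n ≠ 0 := by
  intro h
  have h2 := congrArg (fun f : LaurentSeries ℚ => f.coeff 0) h
  rw [q_pow] at h2
  have hn' : (0 : ℤ) ≠ (n : ℤ) := by omega
  simp [HahnSeries.coeff_single_of_ne hn'] at h2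

lemma poch_ne (n : ℕ) : poch q q n ≠ 0 := by
  unfold poch
  rw [Finset.prod_ne_zero_iff]
  intro j _
  have := one_sub_q_pow_ne (j + 1) (by omega)
  rwa [pow_succ'] at this

lemma poch_succ (n : ℕ) : poch q q (n + 1) = poch q q n * (1 - q ^ (n + 1)) := by
  unfold poch
  rw [Finset.prod_range_succ, pow_succ']

/-- reciprocal of `(q)_m`, zero for negative `m`. -/
noncomputable def rr (m : ℤ) : LaurentSeries ℚ :=
  if m < 0 then 0 else (poch q q m.toNat)⁻¹

lemma rr_neg (m : ℤ) (h : m < 0) : rr m = 0 := by simp [rr, h]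

lemma rr_nat (m : ℕ) : rr (m : ℤ) = (poch q q m)⁻¹ := by
  unfold rr
  rw [if_neg (by omega)]
  simp

lemma rr_pred (m : ℤ) : rr (m - 1) = (1 - q ^ m) * rr m := by
  rcases lt_trichotomy m 0 with h | h | h
  · rw [rr_neg _ h, rr_neg _ (by omega)]; simp
  · subst h; rw [rr_neg _ (by omega)]; simp
  · obtain ⟨k, rfl⟩ : ∃ k : ℕ, m = (k : ℤ) + 1 := ⟨(m - 1).toNat, by omega⟩
    have h1 : ((k : ℤ) + 1) = ((k + 1 : ℕ) : ℤ) := by push_cast; ring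
    rw [add_sub_cancel_right, h1, rr_nat, rr_nat, poch_succ, zpow_natCast]
    have := one_sub_q_pow_ne (k + 1) (by omega)
    have := poch_ne k
    field_simp

noncomputable def uu (k : ℕ) : LaurentSeries ℚ := q ^ (-(k.choose 2 : ℤ))

lemma uu_succ (k : ℕ) : uu k = uu (k + 1) * q ^ k := by
  unfold uu
  rw [← zpow_natCast q k, ← zpow_add₀ q_ne]
  congr 1
  rw [Nat.choose_succ_succ' k 1]
  push_cast
  simp

/-- weights -/
noncomputable def ww (k : ℕ) : LaurentSeries ℚ := if k = 0 then 1 else uu (k + 1) + uu k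

noncomputable def YY (M : ℕ) (K : ℕ) : LaurentSeries ℚ :=
  ∑ k ∈ Finset.range K, (-1) ^ k * ww k * (rr ((M : ℤ) - k) * rr ((M : ℤ) + k))

lemma YY_rec_partial (M K : ℕ) :
    YY (M + 1) (K + 1) * ((1 - q ^ (M + 1)) * q ^ (M + 1)) + YY M (K + 1)
      = (-1) ^ K * uu (K + 1) * (rr ((M : ℤ) - K) * rr ((M : ℤ) + 1 + K)) := by
  induction K with
  | zero =>
    have h := rr_pred ((M : ℤ) + 1)
    have hq : q ^ ((M : ℤ) + 1) = q ^ (M + 1) := by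
      rw [← zpow_natCast q (M + 1)]; push_cast; rfl
    rw [add_sub_cancel_right, hq] at h
    simp [YY, ww, uu, h]
    ring
  | succ K ih =>
    have e1 : YY (M + 1) (K + 1 + 1) = YY (M + 1) (K + 1) + (-1) ^ (K + 1) * ww (K + 1) *
        (rr ((M : ℤ) - K) * rr ((M : ℤ) + K + 2)) := by
      unfold YY
      rw [Finset.sum_range_succ]
      congr 4 <;> push_cast <;> ring
    have e2 : YY M (K + 1 + 1) = YY M (K + 1) + (-1) ^ (K + 1) * ww (K + 1) *
        (rr ((M : ℤ) - K - 1) * rr ((M : ℤ) + K + 1)) := by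
      unfold YY
      rw [Finset.sum_range_succ]
      congr 4 <;> push_cast <;> ring
    have r1 := rr_pred ((M : ℤ) - K)
    have r2 := rr_pred ((M : ℤ) + K + 2)
    rw [show (M : ℤ) + K + 2 - 1 = M + K + 1 by ring] at r2
    have e3 : (M : ℤ) - (K + 1 : ℕ) = M - K - 1 := by push_cast; ring
    have e4 : (M : ℤ) + 1 + (K + 1 : ℕ) = M + K + 2 := by push_cast; ring
    have e5 : (M : ℤ) + 1 + K = M + K + 1 := by ring
    have hw : ww (K + 1) = uu (K + 2) * (1 + q ^ (K + 1)) := by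
      unfold ww
      rw [if_neg (by omega), uu_succ (K + 1)]; ring
    have hu := uu_succ (K + 1)
    have z1 : q ^ ((M : ℤ) - K) = q ^ M * (q ^ K)⁻¹ := by
      rw [zpow_sub₀ q_ne, zpow_natCast, zpow_natCast]; rfl
    have z2 : q ^ ((M : ℤ) + K + 2) = q ^ M * q ^ K * q ^ 2 := by
      rw [zpow_add₀ q_ne, zpow_add₀ q_ne, zpow_natCast, zpow_natCast]; rfl
    rw [e5] at ih
    rw [e1, e2, e3, e4, hw]
    rw [z1] at r1
    rw [z2] at r2
    rw [r2, hu] at ih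
    rw [r1, r2]
    have hx : q ^ K ≠ 0 := pow_ne_zero _ q_ne
    simp only [pow_succ] at *
    generalize q ^ K = x at *
    generalize q ^ M = N at *
    generalize rr ((M : ℤ) - K) = A at *
    generalize rr ((M : ℤ) + K + 2) = B at *
    generalize uu (K + 1 + 1) = U at *
    generalize YY (M + 1) (K + 1) = Y1 at *
    generalize YY M (K + 1) = Y0 at *
    have : Y0 = (-1) ^ K * (U * (x * q)) * (A * ((1 - N * x * (1 * q * q)) * B)) 
        - Y1 * ((1 - N * q) * (N * q)) := by linear_combination ih
    rw [this]
    field_simp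
    ring

lemma YY_extend (M : ℕ) : YY M (M + 2) = YY M (M + 1) := by
  unfold YY
  rw [Finset.sum_range_succ _ (M + 1), rr_neg ((M : ℤ) - (M + 1 : ℕ)) (by push_cast; omega)]
  simp

lemma YY_eq (M : ℕ) : YY M (M + 1) = (-1) ^ M * uu (M + 1) * rr M := by
  induction M with
  | zero => 
    have : rr 0 = 1 := by simp [rr, poch]
    simp [YY, ww, uu, this]
  | succ M ih =>
    have h := YY_rec_partial M (M + 1)
    rw [rr_neg ((M : ℤ) - (M + 1 : ℕ)) (by push_cast; omega), YY_extend M, ih] at h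
    have r := rr_pred ((M : ℤ) + 1)
    have hq : q ^ ((M : ℤ) + 1) = q ^ (M + 1) := by
      rw [← zpow_natCast q (M + 1)]; push_cast; rfl
    rw [add_sub_cancel_right, hq] at r
    rw [r, uu_succ (M + 1)] at h
    have hne : (1 - q ^ (M + 1)) * q ^ (M + 1) ≠ 0 :=
      mul_ne_zero (one_sub_q_pow_ne _ (by omega)) (pow_ne_zero _ q_ne)
    apply mul_right_cancel₀ hne
    rw [show ((M + 1 : ℕ) : ℤ) = (M : ℤ) + 1 by push_cast; rfl]
    linear_combination h

/-- the common sequence -/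
noncomputable def XX (m : ℕ) : LaurentSeries ℚ :=
  if m % 2 = 0 then q ^ (2 * (m / 2) ^ 2 - 2 * (m / 2)) *
    ∑ j ∈ Finset.Icc (-((m / 2 : ℕ) : ℤ)) (((m / 2 : ℕ) : ℤ) - 1), q ^ (-4 * j ^ 2 - 3 * j)
  else q ^ (2 * (m / 2) ^ 2) *
    ∑ j ∈ Finset.Icc (-((m / 2 : ℕ) : ℤ)) ((m / 2 : ℕ) : ℤ), q ^ (-4 * j ^ 2 - j)

lemma XX_even (n : ℕ) : XX (2 * n) = q ^ (2 * (n : ℤ) ^ 2 - 2 * n) *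
    ∑ j ∈ Finset.Icc (-(n : ℤ)) ((n : ℤ) - 1), q ^ (-4 * j ^ 2 - 3 * j) := by
  unfold XX
  rw [if_pos (by omega), show 2 * n / 2 = n by omega]
  congr 1
  rw [← zpow_natCast]
  congr 1
  rw [Nat.cast_sub (by nlinarith)]
  push_cast; ring

lemma XX_odd (n : ℕ) : XX (2 * n + 1) = q ^ (2 * (n : ℤ) ^ 2) *
    ∑ j ∈ Finset.Icc (-(n : ℤ)) (n : ℤ), q ^ (-4 * j ^ 2 - j) := by
  unfold XX
  rw [if_neg (by omega), show (2 * n + 1) / 2 = n by omega]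
  congr 1

lemma sum_Icc_ends (f : ℤ → LaurentSeries ℚ) (a b : ℤ) (h : a ≤ b + 1) :
    ∑ j ∈ Finset.Icc (a - 1) (b + 1), f j = ∑ j ∈ Finset.Icc a b, f j + f (a - 1) + f (b + 1) := by
  have e : Finset.Icc (a - 1) (b + 1) = insert (a - 1) (insert (b + 1) (Finset.Icc a b)) := by
    ext x; simp; omega
  rw [e, Finset.sum_insert (by simp; omega), Finset.sum_insert (by simp)]
  ring

lemma choose_two_cast (k : ℕ) : 2 * ((k.choose 2 : ℕ) : ℤ) = k * (k - 1) := by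
  induction k with
  | zero => simp
  | succ k ih =>
    rw [Nat.choose_succ_succ' k 1]
    push_cast
    simp
    linarith

lemma uu_eq (k : ℕ) (e : ℤ) (h : 2 * e = -(k * (k - 1))) : uu k = q ^ e := by
  unfold uu
  congr 1
  have := choose_two_cast k
  linarith

lemma XX_zero : XX 0 = 0 := by simp [XX]
lemma XX_one : XX 1 = 1 := by simp [XX]

lemma XX_rec (k : ℕ) : XX (k + 2) = q ^ (2 * k) * XX k + (uu (k + 2) + uu (k + 1)) := by
  obtain ⟨n, rfl | rfl⟩ := Nat.even_or_odd' k
  · rw [show 2 * n + 2 = 2 * (n + 1) by ring, XX_even, XX_even]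
    rw [show (-((n + 1 : ℕ) : ℤ)) = -(n : ℤ) - 1 by push_cast; ring,
      show ((n + 1 : ℕ) : ℤ) - 1 = ((n : ℤ) - 1) + 1 by push_cast; ring,
      sum_Icc_ends _ _ _ (by omega), ← zpow_natCast q (2 * (2 * n)), ← mul_assoc,
      ← zpow_add₀ q_ne,
      uu_eq (2 * (n + 1)) (-((n : ℤ) + 1) * (2 * n + 1)) (by push_cast; ring),
      uu_eq (2 * n + 1) (-(n : ℤ) * (2 * n + 1)) (by push_cast; ring), mul_add, mul_add,
      ← zpow_add₀ q_ne, ← zpow_add₀ q_ne, add_assoc]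
    congr 1
    · congr 2; push_cast; ring
    · congr 2 <;> push_cast <;> ring
  · rw [show 2 * n + 1 + 2 = 2 * (n + 1) + 1 by ring, XX_odd, XX_odd]
    rw [show (-((n + 1 : ℕ) : ℤ)) = -(n : ℤ) - 1 by push_cast; ring,
      show ((n + 1 : ℕ) : ℤ) = (n : ℤ) + 1 by push_cast; ring,
      sum_Icc_ends _ _ _ (by omega), ← zpow_natCast q (2 * (2 * n + 1)), ← mul_assoc,
      ← zpow_add₀ q_ne,
      uu_eq (2 * (n + 1) + 1) (-((n : ℤ) + 1) * (2 * n + 3)) (by push_cast; ring),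
      uu_eq (2 * n + 1 + 1) (-((n : ℤ) + 1) * (2 * n + 1)) (by push_cast; ring), mul_add, mul_add,
      ← zpow_add₀ q_ne, ← zpow_add₀ q_ne, add_assoc,
      add_comm (q ^ (-((n : ℤ) + 1) * (2 * n + 3)))]
    congr 1
    · congr 2; push_cast; ring
    · congr 2 <;> push_cast <;> ring

lemma a_eq (m : ℕ) : a m = (-1) ^ m * (1 - q ^ (2 * m)) * XX m := by
  obtain ⟨n, rfl | rfl⟩ := Nat.even_or_odd' m
  · unfold a XX aEven
    rw [if_pos (by omega), if_pos (by omega), show 2 * n / 2 = n by omega, pow_mul (-1)]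
    ring_nf
  · unfold a XX aOdd
    rw [if_neg (by omega), if_neg (by omega), show (2 * n + 1) / 2 = n by omega, pow_succ (-1),
      pow_mul (-1)]
    ring_nf

lemma alpha_eq (m : ℕ) : α m = (-1) ^ m * (XX (m + 1) + q ^ (2 * m) * XX m) / (1 - q) := by
  obtain ⟨n, rfl | rfl⟩ := Nat.even_or_odd' m
  · rw [XX_odd, XX_even]
    unfold α αEven
    rw [if_pos (by omega), show 2 * n / 2 = n by omega, pow_mul (-1), ← mul_assoc,
      ← zpow_natCast q (2 * (2 * n)), ← zpow_add₀ q_ne, ← zpow_natCast, ← zpow_natCast]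
    rw [show ((2 * (2 * n) : ℕ) : ℤ) + (2 * (n : ℤ) ^ 2 - 2 * n) = ((2 * n ^ 2 + 2 * n : ℕ) : ℤ) by
      push_cast; ring]
    simp
  · rw [show 2 * n + 1 + 1 = 2 * (n + 1) by ring, XX_odd, XX_even]
    unfold α αOdd
    rw [if_neg (by omega), show (2 * n + 1) / 2 = n by omega, pow_succ (-1), pow_mul (-1), ← mul_assoc,
      ← zpow_natCast q (2 * (2 * n + 1)), ← zpow_add₀ q_ne, ← zpow_natCast, ← zpow_natCast]
    rw [show ((2 * (2 * n + 1) : ℕ) : ℤ) + 2 * (n : ℤ) ^ 2 = ((2 * n ^ 2 + 4 * n + 2 : ℕ) : ℤ) by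
      push_cast; ring,
      show 2 * ((n + 1 : ℕ) : ℤ) ^ 2 - 2 * ((n + 1 : ℕ) : ℤ) = ((2 * n ^ 2 + 2 * n : ℕ) : ℤ) by
      push_cast; ring,
      show (-((n + 1 : ℕ) : ℤ)) = -(n : ℤ) - 1 by push_cast; ring,
      show ((n + 1 : ℕ) : ℤ) - 1 = (n : ℤ) by push_cast; ring]
    simp [neg_div]
    ring

/-- partial sums for (i), with `n = M + 1` -/
lemma part_one (M K : ℕ) :
    (1 - q ^ (2 * M + 1)) * ∑ k ∈ Finset.range (K + 2), (-1) ^ k * (1 - q ^ (2 * k)) * XX k *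
      (rr ((M : ℤ) + 1 - k) * rr ((M : ℤ) + 1 + k)) =
    - YY M (K + 1) - (-1) ^ K * XX K * q ^ (2 * K) * (rr ((M : ℤ) - K - 1) * rr ((M : ℤ) + K + 1))
     + (-1) ^ K * XX (K + 1) * q ^ (2 * K + 2) * (rr ((M : ℤ) - K - 2) * rr ((M : ℤ) + K + 2)) := by
  have key : ∀ k : ℕ, (1 - q ^ (2 * M + 1)) * ((1 - q ^ (2 * k)) *
      (rr ((M : ℤ) + 1 - k) * rr ((M : ℤ) + 1 + k))) =
      rr ((M : ℤ) + 1 - k) * rr ((M : ℤ) - 1 + k) -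
        q ^ (2 * k) * (rr ((M : ℤ) - 1 - k) * rr ((M : ℤ) + 1 + k)) := by
    intro k
    have h1 := rr_pred ((M : ℤ) + 1 - k)
    have h2 := rr_pred ((M : ℤ) + 1 - k - 1)
    have h3 := rr_pred ((M : ℤ) + 1 + k)
    have h4 := rr_pred ((M : ℤ) + 1 + k - 1)
    rw [h1] at h2
    rw [h3] at h4
    rw [show (M : ℤ) + 1 - k - 1 - 1 = M - 1 - k by ring] at h2
    rw [show (M : ℤ) + 1 + k - 1 - 1 = M - 1 + k by ring] at h4
    rw [h2, h4]
    have hx : q ^ k ≠ 0 := pow_ne_zero _ q_ne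
    have hq := q_ne
    simp only [zpow_add₀ q_ne, zpow_sub₀ q_ne, zpow_natCast, zpow_one, pow_add, pow_one,
      mul_comm 2, pow_mul]
    field_simp
    ring
  induction K with
  | zero =>
    rw [Finset.sum_range_succ, Finset.sum_range_one, XX_zero]
    have := key 1
    simp only [XX_one] 
    simp [YY, ww, XX_one] at *
    rw [show (M : ℤ) - 1 - 1 = M - 2 by ring, show (M : ℤ) + 1 + 1 = M + 2 by ring] at this
    rw [show (M : ℤ) + 1 + 1 = M + 2 by ring]
    linear_combination -this
  | succ K ih =>
    rw [Finset.sum_range_succ, mul_add, ih]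
    have h := key (K + 2)
    have e2 : YY M (K + 1 + 1) = YY M (K + 1) + (-1) ^ (K + 1) * (uu (K + 2) + uu (K + 1)) *
        (rr ((M : ℤ) - K - 1) * rr ((M : ℤ) + K + 1)) := by
      unfold YY
      rw [Finset.sum_range_succ, ww, if_neg (by omega)]
      congr 4 <;> push_cast <;> ring
    rw [e2]
    have hx := XX_rec K
    rw [show K + 1 + 1 = K + 2 by ring]
    push_cast at h ⊢
    rw [show (M : ℤ) + 1 - (K + 2) = M - K - 1 by ring,
      show (M : ℤ) - 1 + (K + 2) = M + K + 1 by ring,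
      show (M : ℤ) - 1 - (K + 2) = M - K - 3 by ring,
      show (M : ℤ) + 1 + (K + 2) = M + K + 3 by ring] at h
    rw [show (M : ℤ) + 1 - (K + 2) = M - K - 1 by ring,
      show (M : ℤ) + 1 + (K + 2) = M + K + 3 by ring,
      show (M : ℤ) - (K + 1) - 1 = M - K - 2 by ring,
      show (M : ℤ) - (K + 1) - 2 = M - K - 3 by ring,
      show (M : ℤ) + (K + 1) + 1 = M + K + 2 by ring,
      show (M : ℤ) + (K + 1) + 2 = M + K + 3 by ring]
    linear_combination (-1) ^ K * XX (K + 2) * h + (-1) ^ K * (rr ((M : ℤ) - K - 1) * rr ((M : ℤ) + K + 1)) * hx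

lemma sum_one (M : ℕ) :
    ∑ k ∈ Finset.range (M + 2), (-1) ^ k * (1 - q ^ (2 * k)) * XX k *
      (rr ((M : ℤ) + 1 - k) * rr ((M : ℤ) + 1 + k)) =
    (-1) ^ (M + 1) * uu (M + 1) * rr M / (1 - q ^ (2 * M + 1)) := by
  have h := part_one M M
  rw [rr_neg ((M : ℤ) - M - 1) (by omega), rr_neg ((M : ℤ) - M - 2) (by omega), YY_eq] at h
  rw [eq_div_iff (one_sub_q_pow_ne _ (by omega))]
  linear_combination h

lemma part_two (n K : ℕ) :
    ∑ k ∈ Finset.range K, (-1) ^ k * (XX (k + 1) + q ^ (2 * k) * XX k) *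
      (rr ((n : ℤ) - k) * rr ((n : ℤ) + 1 + k)) =
    - ∑ k ∈ Finset.range K, (-1) ^ k * (1 - q ^ (2 * k)) * XX k *
      (rr ((n : ℤ) + 1 - k) * rr ((n : ℤ) + 1 + k))
    - (-1) ^ K * XX K * (rr ((n : ℤ) + 1 - K) * rr ((n : ℤ) + K)) := by
  induction K with
  | zero => simp [XX_zero]
  | succ K ih =>
    rw [Finset.sum_range_succ, Finset.sum_range_succ, ih]
    have h1 := rr_pred ((n : ℤ) + 1 - K)
    have h3 := rr_pred ((n : ℤ) + 1 + K)
    rw [show (n : ℤ) + 1 - K - 1 = n - K by ring] at h1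
    rw [show (n : ℤ) + 1 + K - 1 = n + K by ring] at h3
    push_cast
    rw [show (n : ℤ) + 1 - (K + 1) = n - K by ring, show (n : ℤ) + (K + 1) = n + 1 + K by ring,
      h1, h3]
    have hx : q ^ K ≠ 0 := pow_ne_zero _ q_ne
    have hq := q_ne
    simp only [zpow_add₀ q_ne, zpow_sub₀ q_ne, zpow_natCast, zpow_one, pow_add, pow_one,
      mul_comm 2, pow_mul]
    field_simp
    ring

lemma poch_q_sq (n : ℕ) : (1 - q) * poch (q * q) q n = poch q q (n + 1) := by
  unfold poch
  rw [Finset.prod_range_succ', mul_comm]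
  congr 1
  · apply Finset.prod_congr rfl
    intro j _
    ring
  · simp

/-- Proposition 2.2: `(a, b)` is a Bailey pair relative to `1` and `(α, β)` is a Bailey
pair relative to `q`. -/
theorem bailey_pairs_prop2 : IsBaileyPair 1 a b ∧ IsBaileyPair q α β := by
  constructor
  · intro n
    have h : ∑ k ∈ Finset.range (n + 1), a k / (poch q q (n - k) * poch (1 * q) q (n + k)) =
        ∑ k ∈ Finset.range (n + 1), (-1) ^ k * (1 - q ^ (2 * k)) * XX k *
          (rr ((n : ℤ) - k) * rr ((n : ℤ) + k)) := by
      apply Finset.sum_congr rfl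
      intro k hk
      have hk' : k ≤ n := by simpa [Nat.lt_succ_iff] using hk
      rw [a_eq, one_mul, ← Nat.cast_sub hk', ← Nat.cast_add, rr_nat, rr_nat, div_eq_mul_inv,
        mul_inv]
    rw [h]
    cases n with
    | zero => simp [b, XX_zero]
    | succ M =>
      have h2 := sum_one M
      push_cast
      rw [h2]
      unfold b
      rw [if_neg (by omega), rr_nat, uu, show 2 * (M + 1) - 1 = 2 * M + 1 by omega,
        add_tsub_cancel_right, div_eq_mul_inv, div_eq_mul_inv, mul_inv]
      ring
  · intro n
    have h : ∑ k ∈ Finset.range (n + 1), α k / (poch q q (n - k) * poch (q * q) q (n + k)) =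
        ∑ k ∈ Finset.range (n + 2), (-1) ^ k * (XX (k + 1) + q ^ (2 * k) * XX k) *
      (rr ((n : ℤ) - k) * rr ((n : ℤ) + 1 + k)) := by
      rw [Finset.sum_range_succ _ (n + 1), rr_neg ((n : ℤ) - (n + 1 : ℕ)) (by push_cast; omega),
        zero_mul, mul_zero, add_zero]
      apply Finset.sum_congr rfl
      intro k hk
      have hk' : k ≤ n := by simpa [Nat.lt_succ_iff] using hk
      rw [alpha_eq, ← Nat.cast_sub hk',
        show (n : ℤ) + 1 + k = ((n + k + 1 : ℕ) : ℤ) by push_cast; ring, rr_nat, rr_nat,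
        ← poch_q_sq, div_div, div_eq_mul_inv, mul_inv, mul_inv, mul_inv]
      ring
    rw [h, part_two, sum_one, rr_neg ((n : ℤ) + 1 - (n + 2 : ℕ)) (by push_cast; omega)]
    · unfold β
      rw [rr_nat, uu, div_eq_mul_inv, div_eq_mul_inv, mul_inv]
      ring
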